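/- Let n ≥ 2 and 1 ≤ k ≤ n−1 be integers, let p > 2k be a real number, and let γ = γ_p := k^k (p−2k)^{(p−2k)/2} p^{−p/2} C(n,k). Then the equation σ_k(A[φ]) = φ^{p−k} γ on 𝕊ⁿ has a unique even, uniformly h-convex solution, namely the constant φ ≡ (p/(p−2k))^{1/2}. -/

import Mathlib

open scoped RealInnerProductSpace
open Finset

noncomputable section

/-- Euclidean space `ℝ^(n+1)`, the ambient space of the unit sphere `𝕊ⁿ`. -/
abbrev Euc (n : ℕ) : Type := EuclideanSpace ℝ (Fin (n + 1))

/-- The unit sphere `𝕊ⁿ ⊆ ℝ^(n+1)`. -/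
def uSphere (n : ℕ) : Set (Euc n) := Metric.sphere (0 : Euc n) 1

/-- Orthogonal projection onto the tangent space of the sphere at (the normalization of) `x`. -/
def tanProj {n : ℕ} (x v : Euc n) : Euc n := v - (⟪x, v⟫ / ‖x‖ ^ 2) • x

/-- `f` is (the 0-homogeneous extension of) a function on the sphere. -/
def Homog0 {n : ℕ} (f : Euc n → ℝ) : Prop := ∀ (c : ℝ) (y : Euc n), 0 < c → f (c • y) = f y

/-- Smoothness of a function on the sphere, expressed via its 0-homogeneous extension. -/
def SmoothFn {n : ℕ} (f : Euc n → ℝ) : Prop := ContDiffOn ℝ (⊤ : ℕ∞) f {y : Euc n | y ≠ 0}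

/-- `f(x) = f(-x)` for all `x`. -/
def EvenFn {n : ℕ} (f : Euc n → ℝ) : Prop := ∀ y, f (-y) = f y

/-- Covariant (tangential) derivative of a function on the sphere, in direction `v`. -/
def covD {n : ℕ} (f : Euc n → ℝ) (x v : Euc n) : ℝ := fderiv ℝ f x (tanProj x v)

/-- Spherical (tangential) gradient. -/
def gradS {n : ℕ} (f : Euc n → ℝ) (x : Euc n) : Euc n := tanProj x (gradient f x)

/-- Covariant Hessian `(D²f)(v,w)` of a function on the round sphere. -/
def hessS {n : ℕ} (f : Euc n → ℝ) (x v w : Euc n) : ℝ :=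
  fderiv ℝ (fun y => covD f y w) x (tanProj x v)

/-- The symmetric 2-tensor
`A[φ](v,w) = (D²φ)(v,w) - (|Dφ|²/(2φ)) σ(v,w) + ((φ - 1/φ)/2) σ(v,w)` on the sphere. -/
def Aform {n : ℕ} (φ : Euc n → ℝ) (x v w : Euc n) : ℝ :=
  hessS φ x v w +
    ((φ x - (φ x)⁻¹) / 2 - ‖gradS φ x‖ ^ 2 / (2 * φ x)) * ⟪tanProj x v, tanProj x w⟫

/-- `φ` is h-convex: `A[φ] ≥ 0` on the sphere. -/
def HConvex {n : ℕ} (φ : Euc n → ℝ) : Prop :=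
  ∀ x ∈ uSphere n, ∀ v : Euc n, ⟪x, v⟫ = 0 → 0 ≤ Aform φ x v v

/-- `φ` is uniformly h-convex: `A[φ] > 0` on the sphere. -/
def UnifHConvex {n : ℕ} (φ : Euc n → ℝ) : Prop :=
  ∀ x ∈ uSphere n, ∀ v : Euc n, ⟪x, v⟫ = 0 → v ≠ 0 → 0 < Aform φ x v v

/-- `σ_k` of a square matrix: the sum of its principal `k × k` minors
(equivalently, the `k`-th elementary symmetric function of its eigenvalues). -/
def sigmaMat {N : ℕ} (k : ℕ) (M : Matrix (Fin N) (Fin N) ℝ) : ℝ :=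
  ∑ s ∈ Finset.powersetCard k (Finset.univ : Finset (Fin N)),
    Matrix.det (Matrix.of fun i j : {a : Fin N // a ∈ s} => M i.1 j.1)

/-- `e` is an orthonormal frame of the tangent space of `𝕊ⁿ` at `x`. -/
def OrthoFrame {n : ℕ} (x : Euc n) (e : Fin n → Euc n) : Prop :=
  (∀ i, ⟪x, e i⟫ = 0) ∧ ∀ i j, ⟪e i, e j⟫ = if i = j then 1 else 0

/-- The matrix of `A[φ]` at `x` with respect to an orthonormal tangent frame `e`. -/
def Amat {n : ℕ} (φ : Euc n → ℝ) (x : Euc n) (e : Fin n → Euc n) : Matrix (Fin n) (Fin n) ℝ :=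
  Matrix.of fun i j => Aform φ x (e i) (e j)

/-- `φ` solves the horospherical `p`-Christoffel-Minkowski equation
`σ_k(A[φ]) = φ^(p-k) f` on `𝕊ⁿ`. -/
def SolvesCM (n k : ℕ) (p : ℝ) (f φ : Euc n → ℝ) : Prop :=
  ∀ x ∈ uSphere n, ∀ e : Fin n → Euc n, OrthoFrame x e →
    sigmaMat k (Amat φ x e) = φ x ^ (p - (k : ℝ)) * f x

/-- Supremum (maximum) of a function over the sphere. -/
def sphSup {n : ℕ} (f : Euc n → ℝ) : ℝ := sSup (f '' uSphere n)

/-- Infimum (minimum) of a function over the sphere. -/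
def sphInf {n : ℕ} (f : Euc n → ℝ) : ℝ := sInf (f '' uSphere n)

/-- The function `f^(-1/q)`. -/
def negPowExt {n : ℕ} (f : Euc n → ℝ) (q : ℝ) : Euc n → ℝ := fun y => f y ^ (-(1 / q))

/-- Assumption 1.3 of the paper (Assumption (A)): the gradient-and-Hessian conditions on the
prescribed function `f`, according to the value of `p`. -/
def AssumptionA (n k : ℕ) (p : ℝ) (f : Euc n → ℝ) : Prop :=
  ((p = 0) →
    ∀ x ∈ uSphere n, ∀ v : Euc n, ⟪x, v⟫ = 0 →
      0 ≤ hessS (negPowExt f (k : ℝ)) x v v - ‖gradS (negPowExt f (k : ℝ)) x‖ * ‖v‖ ^ 2 +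
          negPowExt f (k : ℝ) x /
              (2 + 8 * sphSup fun y => (f y / (n.choose k : ℝ)) ^ (1 / (k : ℝ))) * ‖v‖ ^ 2) ∧
  ((0 < p ∧ p ≤ (k : ℝ) / 2) →
    ∀ x ∈ uSphere n, ∀ v : Euc n, ⟪x, v⟫ = 0 →
      0 ≤ hessS (negPowExt f (k : ℝ)) x v v -
            (((k : ℝ) + 2 * p) / (k : ℝ)) * ‖gradS (negPowExt f (k : ℝ)) x‖ * ‖v‖ ^ 2 +
          (p ^ 2 / (k : ℝ) ^ 2) * negPowExt f (k : ℝ) x * ‖v‖ ^ 2) ∧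
  (((k : ℝ) / 2 < p ∧ p < (k : ℝ)) →
    ∀ x ∈ uSphere n, ∀ v : Euc n, ⟪x, v⟫ = 0 →
      0 ≤ hessS (negPowExt f (k : ℝ)) x v v -
            ((3 * (k : ℝ) - 2 * p) ^ 2 / (p * (2 * p - (k : ℝ)))) *
              (‖gradS (negPowExt f (k : ℝ)) x‖ ^ 2 / (2 * negPowExt f (k : ℝ) x)) * ‖v‖ ^ 2 +
          (p / (2 * (k : ℝ))) * negPowExt f (k : ℝ) x * ‖v‖ ^ 2) ∧
  (((k : ℝ) ≤ p ∧ p < 2 * (k : ℝ)) →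
    ∀ x ∈ uSphere n, ∀ v : Euc n, ⟪x, v⟫ = 0 →
      0 ≤ hessS (negPowExt f p) x v v -
            (‖gradS (negPowExt f p) x‖ ^ 2 / (2 * negPowExt f p x)) * ‖v‖ ^ 2 +
          (1 / 2) * negPowExt f p x * ‖v‖ ^ 2) ∧
  ((p = 2 * (k : ℝ)) →
    sphSup f < (n.choose k : ℝ) / 2 ^ k ∧
    ∀ x ∈ uSphere n, ∀ v : Euc n, ⟪x, v⟫ = 0 →
      0 ≤ hessS (negPowExt f p) x v v -
            (‖gradS (negPowExt f p) x‖ ^ 2 / (2 * negPowExt f p x)) * ‖v‖ ^ 2 +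
          (1 / 2) * negPowExt f p x * ‖v‖ ^ 2) ∧
  ((2 * (k : ℝ) < p) →
    2 ≤ k ∧
    sphInf f ≤
      (k : ℝ) ^ k * (p - 2 * (k : ℝ)) ^ ((p - 2 * (k : ℝ)) / 2) / p ^ (p / 2) * (n.choose k : ℝ) ∧
    ∀ x ∈ uSphere n, ∀ v : Euc n, ⟪x, v⟫ = 0 →
      0 ≤ hessS (negPowExt f p) x v v -
            (‖gradS (negPowExt f p) x‖ ^ 2 / (2 * negPowExt f p x)) * ‖v‖ ^ 2 +
          ((k : ℝ) / p) * negPowExt f p x * ‖v‖ ^ 2)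

/-- The `k`-th elementary symmetric function of the numbers `a i`, `i ∈ s`. -/
def elemSymm {ι : Type*} (k : ℕ) (s : Finset ι) (a : ι → ℝ) : ℝ :=
  ∑ t ∈ s.powersetCard k, ∏ i ∈ t, a i

lemma elemSymm_zero {ι : Type*} (s : Finset ι) (a : ι → ℝ) : elemSymm 0 s a = 1 := by
  simp [elemSymm]

lemma elemSymm_succ_empty {ι : Type*} (k : ℕ) (a : ι → ℝ) : elemSymm (k + 1) ∅ a = 0 := by
  rw [elemSymm, Finset.powersetCard_eq_empty.2 (by simp), Finset.sum_empty]

lemma elemSymm_nonneg {ι : Type*} (k : ℕ) (s : Finset ι) {a : ι → ℝ} (ha : ∀ i ∈ s, 0 ≤ a i) :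
    0 ≤ elemSymm k s a :=
  Finset.sum_nonneg fun _ ht => Finset.prod_nonneg fun i hi =>
    ha i ((Finset.mem_powersetCard.1 ht).1 hi)

lemma elemSymm_insert {ι : Type*} [DecidableEq ι] (k : ℕ) {s : Finset ι} {j : ι} (hj : j ∉ s)
    (a : ι → ℝ) :
    elemSymm (k + 1) (insert j s) a = elemSymm (k + 1) s a + a j * elemSymm k s a := by
  unfold elemSymm
  have hmem : ∀ t ∈ s.powersetCard k, j ∉ t := fun t ht h =>
    hj ((Finset.mem_powersetCard.1 ht).1 h)
  rw [Finset.powersetCard_succ_insert hj, Finset.sum_union, Finset.sum_image, Finset.mul_sum]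
  · congr 1
    exact Finset.sum_congr rfl fun t ht => Finset.prod_insert (hmem t ht)
  · intro t ht u hu h
    rw [← Finset.erase_insert (hmem t ht), ← Finset.erase_insert (hmem u hu), h]
  · rw [Finset.disjoint_left]
    intro t ht h
    obtain ⟨u, -, rfl⟩ := Finset.mem_image.1 h
    exact hj ((Finset.mem_powersetCard.1 ht).1 (Finset.mem_insert_self j u))

lemma elemSymm_eq_erase {ι : Type*} [DecidableEq ι] (k : ℕ) {s : Finset ι} {j : ι} (hj : j ∈ s)
    (a : ι → ℝ) :
    elemSymm (k + 1) s a = elemSymm (k + 1) (s.erase j) a + a j * elemSymm k (s.erase j) a := by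
  conv_lhs => rw [← Finset.insert_erase hj]
  exact elemSymm_insert k (Finset.notMem_erase j s) a

lemma sum_mul_elemSymm_erase {ι : Type*} [DecidableEq ι] (k : ℕ) (s : Finset ι) (a : ι → ℝ) :
    ∑ i ∈ s, a i * elemSymm k (s.erase i) a = (k + 1) * elemSymm (k + 1) s a := by
  induction s using Finset.induction_on generalizing k with
  | empty => rw [elemSymm_succ_empty, Finset.sum_empty, mul_zero]
  | insert j s hj ih =>
    have hne : ∀ i ∈ s, j ≠ i := fun i hi h => hj (h ▸ hi)
    rw [Finset.sum_insert hj, Finset.erase_insert hj, elemSymm_insert k hj]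
    cases k with
    | zero =>
      have h := ih 0
      simp only [elemSymm_zero] at h ⊢
      rw [h]
      push_cast
      ring
    | succ k =>
      have h : ∀ i ∈ s, a i * elemSymm (k + 1) ((insert j s).erase i) a =
          a i * elemSymm (k + 1) (s.erase i) a + a j * (a i * elemSymm k (s.erase i) a) := by
        intro i hi
        rw [Finset.erase_insert_of_ne (hne i hi),
          elemSymm_insert k (fun h => hj (Finset.mem_of_mem_erase h))]
        ring
      rw [Finset.sum_congr rfl h, Finset.sum_add_distrib, ← Finset.mul_sum, ih, ih]
      push_cast
      ring

lemma sum_elemSymm_erase {ι : Type*} [DecidableEq ι] (k : ℕ) (s : Finset ι) (a : ι → ℝ) :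
    ∑ i ∈ s, elemSymm k (s.erase i) a = ((s.card : ℝ) - k) * elemSymm k s a := by
  cases k with
  | zero => simp [elemSymm_zero]
  | succ k =>
    have h : ∀ i ∈ s, elemSymm (k + 1) (s.erase i) a =
        elemSymm (k + 1) s a - a i * elemSymm k (s.erase i) a := fun i hi => by
      rw [elemSymm_eq_erase k hi]
      ring
    rw [Finset.sum_congr rfl h, Finset.sum_sub_distrib, sum_mul_elemSymm_erase]
    simp only [Finset.sum_const, nsmul_eq_mul]
    push_cast
    ring

lemma antivaryOn_elemSymm_erase {ι : Type*} [DecidableEq ι] (k : ℕ) (s : Finset ι) {a : ι → ℝ}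
    (ha : ∀ i ∈ s, 0 ≤ a i) : AntivaryOn a (fun i => elemSymm k (s.erase i) a) s := by
  intro i hi j hj hij
  cases k with
  | zero => simp [elemSymm_zero] at hij
  | succ k =>
    by_contra! hlt
    have hne : i ≠ j := by
      rintro rfl
      exact lt_irrefl _ hlt
    have h₁ := elemSymm_eq_erase k (Finset.mem_erase.2 ⟨hne.symm, hj⟩) a
    have h₂ := elemSymm_eq_erase k (Finset.mem_erase.2 ⟨hne, hi⟩) a
    rw [Finset.erase_right_comm] at h₂
    have h₃ : 0 ≤ elemSymm k ((s.erase i).erase j) a := elemSymm_nonneg k _ fun l hl =>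
      ha l (Finset.mem_of_mem_erase (Finset.mem_of_mem_erase hl))
    simp only [h₁, h₂] at hij
    nlinarith

/-- **Maclaurin's inequality** comparing `σ_k` with `σ_1`. -/
lemma elemSymm_le {ι : Type*} (k : ℕ) (s : Finset ι) {a : ι → ℝ} (ha : ∀ i ∈ s, 0 ≤ a i) :
    elemSymm k s a ≤ (s.card.choose k : ℝ) * ((∑ i ∈ s, a i) / s.card) ^ k := by
  classical
  rcases s.eq_empty_or_nonempty with rfl | hs
  · cases k with
    | zero => simp [elemSymm_zero]
    | succ k =>
      rw [elemSymm_succ_empty]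
      positivity
  have hN : (0 : ℝ) < s.card := by exact_mod_cast hs.card_pos
  have hm : 0 ≤ (∑ i ∈ s, a i) / s.card := div_nonneg (Finset.sum_nonneg ha) hN.le
  induction k with
  | zero => simp [elemSymm]
  | succ k ih =>
    rcases le_or_gt s.card k with hk | hk
    · rw [elemSymm, Finset.powersetCard_eq_empty.2 (by omega), Finset.sum_empty]
      positivity
    have h := (antivaryOn_elemSymm_erase k s ha).card_mul_sum_le_sum_mul_sum
    rw [sum_mul_elemSymm_erase, sum_elemSymm_erase] at h
    have hc : (s.card.choose (k + 1) : ℝ) * (k + 1) = s.card.choose k * ((s.card : ℝ) - k) := by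
      have h' := Nat.choose_succ_right_eq s.card k
      rw [← Nat.cast_sub hk.le]
      exact_mod_cast h'
    have hd : (0 : ℝ) ≤ (s.card : ℝ) - k := by
      rw [sub_nonneg]
      exact_mod_cast hk.le
    set m := (∑ i ∈ s, a i) / s.card with hm_def
    have hsum : ∑ i ∈ s, a i = s.card * m := by
      rw [hm_def]
      field_simp
    rw [hsum, mul_assoc] at h
    have h' := le_of_mul_le_mul_left h hN
    have hk' : (0 : ℝ) < k + 1 := by positivity
    refine le_of_mul_le_mul_left ?_ hk'
    calc (k + 1 : ℝ) * elemSymm (k + 1) s a ≤ m * (((s.card : ℝ) - k) * elemSymm k s a) := h'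
      _ ≤ m * (((s.card : ℝ) - k) * (s.card.choose k * m ^ k)) := by gcongr
      _ = (s.card.choose k * ((s.card : ℝ) - k)) * m ^ (k + 1) := by ring
      _ = (k + 1) * (s.card.choose (k + 1) * m ^ (k + 1)) := by
        rw [← hc]
        ring

/-- **Hadamard's inequality** for positive definite matrices. -/
lemma Matrix.PosDef.det_le_prod_diag {ι : Type*} [Fintype ι] [DecidableEq ι] {A : Matrix ι ι ℝ}
    (hA : A.PosDef) : A.det ≤ ∏ i, A i i := by
  have hd : ∀ i, 0 < A i i := fun i => hA.diag_pos
  set D : Matrix ι ι ℝ := Matrix.diagonal fun i => (√(A i i))⁻¹ with hD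
  have hB : (D.conjTranspose * A * D).PosSemidef :=
    hA.posSemidef.conjTranspose_mul_mul_same D
  have hBii : ∀ i, (D.conjTranspose * A * D) i i = 1 := fun i => by
    have := Real.mul_self_sqrt (hd i).le
    have h0 := (Real.sqrt_pos.2 (hd i)).ne'
    simp only [hD, Matrix.diagonal_conjTranspose, Matrix.mul_diagonal, Matrix.diagonal_mul,
      star_trivial]
    field_simp
    nlinarith
  have htr : ∑ i, (hB.1.eigenvalues i - 1) = 0 := by
    have h := hB.1.trace_eq_sum_eigenvalues
    simp only [Matrix.trace, Matrix.diag_apply, hBii, RCLike.ofReal_real_eq_id, id] at h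
    rw [Finset.sum_sub_distrib, ← h, sub_self]
  have hdet : (D.conjTranspose * A * D).det ≤ 1 := by
    rw [hB.1.det_eq_prod_eigenvalues]
    calc ∏ i, (hB.1.eigenvalues i : ℝ) ≤ ∏ i, Real.exp (hB.1.eigenvalues i - 1) :=
          Finset.prod_le_prod (fun i _ => hB.eigenvalues_nonneg i) fun i _ => by
            linarith [Real.add_one_le_exp (hB.1.eigenvalues i - 1)]
      _ = 1 := by rw [← Real.exp_sum, htr, Real.exp_zero]
  have hprod : (∏ i, √(A i i)) * (∏ i, √(A i i)) = ∏ i, A i i := by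
    rw [← Finset.prod_mul_distrib]
    exact Finset.prod_congr rfl fun i _ => Real.mul_self_sqrt (hd i).le
  have hpos : 0 < ∏ i, √(A i i) := Finset.prod_pos fun i _ => Real.sqrt_pos.2 (hd i)
  rw [Matrix.det_mul, Matrix.det_mul, Matrix.det_conjTranspose, star_trivial, hD,
    Matrix.det_diagonal, Finset.prod_inv_distrib] at hdet
  rw [← hprod]
  field_simp at hdet
  nlinarith

lemma sigmaMat_le_of_posDef {N : ℕ} (k : ℕ) {M : Matrix (Fin N) (Fin N) ℝ} (hM : M.PosDef) :
    sigmaMat k M ≤ (N.choose k : ℝ) * (M.trace / N) ^ k := by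
  have h : sigmaMat k M ≤ elemSymm k Finset.univ fun i => M i i := by
    refine Finset.sum_le_sum fun s _ => ?_
    rw [← Finset.prod_coe_sort s fun i => M i i]
    exact (hM.submatrix (e := fun a : {a : Fin N // a ∈ s} => a.1)
      Subtype.val_injective).det_le_prod_diag
  refine h.trans ?_
  simpa [Matrix.trace] using elemSymm_le k Finset.univ fun i _ => (hM.diag_pos (i := i)).le

lemma sigmaMat_smul_one (N k : ℕ) (c : ℝ) :
    sigmaMat k (c • (1 : Matrix (Fin N) (Fin N) ℝ)) = (N.choose k : ℝ) * c ^ k := by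
  have h : ∀ s ∈ Finset.powersetCard k (Finset.univ : Finset (Fin N)),
      Matrix.det (Matrix.of fun i j : {a : Fin N // a ∈ s} =>
        (c • (1 : Matrix (Fin N) (Fin N) ℝ)) i.1 j.1) = c ^ k := by
    intro s hs
    have : (Matrix.of fun i j : {a : Fin N // a ∈ s} =>
        (c • (1 : Matrix (Fin N) (Fin N) ℝ)) i.1 j.1) = c • 1 := by
      ext i j
      simp only [Matrix.of_apply, Matrix.smul_apply, Matrix.one_apply, Subtype.ext_iff]
    rw [this, Matrix.det_smul, Matrix.det_one, Fintype.card_coe, (Finset.mem_powersetCard.1 hs).2,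
      mul_one]
  rw [sigmaMat, Finset.sum_congr rfl h]
  simp

/-- The profile of constant solutions: `((c - 1/c)/2)^k` is dominated by a multiple of `c^(p-k)`,
with contact only at `c = √(p/(p-2k))`. -/
lemma eq_sqrt_of_le_half_sub_inv_pow {k : ℕ} {p c : ℝ} (hk : 1 ≤ k) (hp : 2 * (k : ℝ) < p)
    (hc : 1 < c)
    (h : c ^ (p - k) * ((k : ℝ) ^ k * (p - 2 * k) ^ ((p - 2 * k) / 2) / p ^ (p / 2)) ≤
      ((c - c⁻¹) / 2) ^ k) :
    c = √(p / (p - 2 * k)) := by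
  have hk0 : (0 : ℝ) < k := by exact_mod_cast hk
  have hp0 : 0 < p := by linarith
  have hm : 0 < p - 2 * k := by linarith
  have hc0 : 0 < c := by linarith
  have hcc : 0 < c - c⁻¹ := by
    have := inv_lt_one_of_one_lt₀ hc
    linarith
  have hlog := Real.log_le_log (by positivity) h
  rw [Real.log_mul (by positivity) (by positivity), Real.log_div (by positivity) (by positivity),
    Real.log_mul (by positivity) (by positivity), Real.log_rpow hc0, Real.log_pow,
    Real.log_rpow hm, Real.log_rpow hp0, Real.log_pow] at hlog
  have hu : 0 < 1 - (c ^ 2)⁻¹ := by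
    have := inv_lt_one_of_one_lt₀ (one_lt_pow₀ hc two_ne_zero)
    linarith
  have hfac : (c - c⁻¹) / 2 = c * (1 - (c ^ 2)⁻¹) / 2 := by
    field_simp
  have h₁ : Real.log ((c - c⁻¹) / 2) =
      Real.log c + (Real.log (p * (1 - (c ^ 2)⁻¹) / (2 * k)) + Real.log k - Real.log p) := by
    rw [hfac, Real.log_div (by positivity) (by positivity),
      Real.log_mul (by positivity) (by positivity),
      Real.log_div (by positivity) (by positivity), Real.log_mul (by positivity) (by positivity),
      Real.log_mul (by positivity) (by positivity)]
    ring
  have h₂ : Real.log (p * (c ^ 2)⁻¹ / (p - 2 * k)) =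
      Real.log p - 2 * Real.log c - Real.log (p - 2 * k) := by
    rw [Real.log_div (by positivity) (by positivity), Real.log_mul (by positivity) (by positivity),
      Real.log_inv, Real.log_pow]
    push_cast
    ring
  have h₃ := Real.log_le_sub_one_of_pos (x := p * (1 - (c ^ 2)⁻¹) / (2 * k)) (by positivity)
  by_contra hne
  have hne' : p * (c ^ 2)⁻¹ / (p - 2 * k) ≠ 1 := by
    intro h1
    apply hne
    have : p / (p - 2 * k) = c ^ 2 := by
      field_simp at h1 ⊢
      exact h1
    rw [this, Real.sqrt_sq hc0.le]
  have h₄ := Real.log_lt_sub_one_of_pos (x := p * (c ^ 2)⁻¹ / (p - 2 * k)) (by positivity) hne'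
  rw [h₁] at hlog
  rw [h₂] at h₄
  have h₃' := mul_le_mul_of_nonneg_left h₃ hk0.le
  have h₄' := mul_lt_mul_of_pos_left h₄ (half_pos hm)
  have e₃ : k * (p * (1 - (c ^ 2)⁻¹) / (2 * k) - 1) = p * (1 - (c ^ 2)⁻¹) / 2 - k := by
    field_simp
  have e₄ : (p - 2 * k) / 2 * (p * (c ^ 2)⁻¹ / (p - 2 * k) - 1) =
      p * (c ^ 2)⁻¹ / 2 - (p - 2 * k) / 2 := by
    field_simp
  rw [e₃] at h₃'
  rw [e₄] at h₄'
  nlinarith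

lemma sqrt_rpow_mul_eq_half_sub_inv_pow {k : ℕ} {p : ℝ} (hk : 1 ≤ k) (hp : 2 * (k : ℝ) < p) :
    √(p / (p - 2 * k)) ^ (p - k) *
      ((k : ℝ) ^ k * (p - 2 * k) ^ ((p - 2 * k) / 2) / p ^ (p / 2)) =
      ((√(p / (p - 2 * k)) - (√(p / (p - 2 * k)))⁻¹) / 2) ^ k := by
  have hk0 : (0 : ℝ) < k := by exact_mod_cast hk
  have hp0 : 0 < p := by linarith
  have hm : 0 < p - 2 * k := by linarith
  set c := √(p / (p - 2 * k)) with hc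
  have hc0 : 0 < c := Real.sqrt_pos.2 (by positivity)
  have hcsq : c ^ 2 = p / (p - 2 * k) := Real.sq_sqrt (by positivity)
  have hfac : (c - c⁻¹) / 2 = c * k / p := by
    have : c⁻¹ = c / c ^ 2 := by field_simp
    rw [this, hcsq]
    field_simp
    ring
  rw [hfac]
  refine Real.log_injOn_pos (by simp only [Set.mem_Ioi]; positivity)
    (by simp only [Set.mem_Ioi]; positivity) ?_
  have hl : 2 * Real.log c = Real.log p - Real.log (p - 2 * k) := by
    rw [← Real.log_div hp0.ne' hm.ne', ← hcsq, Real.log_pow]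
    push_cast
    ring
  rw [Real.log_mul (by positivity) (by positivity), Real.log_div (by positivity) (by positivity),
    Real.log_mul (by positivity) (by positivity), Real.log_rpow hc0, Real.log_pow,
    Real.log_rpow hm, Real.log_rpow hp0, Real.log_pow,
    Real.log_div (by positivity) (by positivity), Real.log_mul (by positivity) (by positivity)]
  linear_combination (p - 2 * k) / 2 * hl

lemma one_lt_sqrt_div_sub {k : ℕ} {p : ℝ} (hk : 1 ≤ k) (hp : 2 * (k : ℝ) < p) :
    1 < √(p / (p - 2 * k)) := by
  have hk0 : (0 : ℝ) < k := by exact_mod_cast hk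
  rw [Real.lt_sqrt zero_le_one, one_pow, one_lt_div (by linarith)]
  linarith

lemma unifHConvex_const {n : ℕ} {c : ℝ} (hc : 1 < c) : UnifHConvex fun _ : Euc n => c := by
  intro x _ v hv hv0
  have hcc : 0 < c - c⁻¹ := by
    have := inv_lt_one_of_one_lt₀ hc
    linarith
  have : 0 < ‖v‖ ^ 2 := by positivity
  simp only [Aform, hessS, covD, gradS, gradient, tanProj, hv, fderiv_fun_const, Pi.zero_apply]
  simpa using by positivity

lemma amat_const {n : ℕ} (c : ℝ) {x : Euc n} {e : Fin n → Euc n} (he : OrthoFrame x e) :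
    Amat (fun _ : Euc n => c) x e = ((c - c⁻¹) / 2) • (1 : Matrix (Fin n) (Fin n) ℝ) := by
  ext i j
  simp [Amat, Aform, hessS, covD, gradS, gradient, tanProj, he.1, he.2, Matrix.one_apply]

namespace Homog0

variable {n : ℕ} {φ : Euc n → ℝ}

lemma fderiv_smul (hφ : Homog0 φ) {c : ℝ} (hc : 0 < c) (x : Euc n) :
    fderiv ℝ φ (c • x) = c⁻¹ • fderiv ℝ φ x := by
  have h : (fun y => φ (c • y)) = φ := funext fun y => hφ c y hc
  have h' := fderiv_comp_smul (f := φ) (x := x) c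
  rw [h] at h'
  rw [h', smul_smul, inv_mul_cancel₀ hc.ne', one_smul]

lemma fderiv_fderiv_smul (hφ : Homog0 φ) {c : ℝ} (hc : 0 < c) (x : Euc n) :
    fderiv ℝ (fderiv ℝ φ) (c • x) = (c ^ 2)⁻¹ • fderiv ℝ (fderiv ℝ φ) x := by
  have h : (fun y => fderiv ℝ φ (c • y)) = c⁻¹ • fderiv ℝ φ := funext fun y => hφ.fderiv_smul hc y
  have h' := fderiv_comp_smul (f := fderiv ℝ φ) (x := x) c
  rw [h, congrFun (fderiv_const_smul_field (𝕜 := ℝ) (f := fderiv ℝ φ) c⁻¹) x] at h'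
  rw [sq, mul_inv, mul_smul, ← Pi.smul_apply c⁻¹ (fderiv ℝ (fderiv ℝ φ)), h', smul_smul, inv_mul_cancel₀ hc.ne', one_smul]

lemma fderiv_apply_self (hφ : Homog0 φ) (x : Euc n) : fderiv ℝ φ x x = 0 := by
  by_cases hd : DifferentiableAt ℝ φ x
  · have h₁ : HasDerivAt (fun t : ℝ => φ (t • x)) (fderiv ℝ φ x x) 1 := by
      have hs : HasDerivAt (fun t : ℝ => t • x) x 1 := by
        simpa using (hasDerivAt_id (1 : ℝ)).smul_const x
      have hd' : HasFDerivAt φ (fderiv ℝ φ x) ((1 : ℝ) • x) := by simpa using hd.hasFDerivAt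
      exact hd'.comp_hasDerivAt 1 hs
    have h₂ : HasDerivAt (fun t : ℝ => φ (t • x)) 0 1 :=
      (hasDerivAt_const 1 (φ x)).congr_of_eventuallyEq <| by
        filter_upwards [lt_mem_nhds (zero_lt_one' ℝ)] with t ht using hφ t x ht
    exact h₁.unique h₂
  · simp [fderiv_zero_of_not_differentiableAt hd]

lemma covD_eq (hφ : Homog0 φ) (x v : Euc n) : covD φ x v = fderiv ℝ φ x v := by
  simp [covD, tanProj, hφ.fderiv_apply_self]

end Homog0

namespace SmoothFn

variable {n : ℕ} {φ : Euc n → ℝ}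

lemma contDiffAt (hs : SmoothFn φ) {x : Euc n} (hx : x ≠ 0) : ContDiffAt ℝ (⊤ : ℕ∞) φ x :=
  ContDiffOn.contDiffAt hs (isOpen_ne.mem_nhds hx)

lemma contDiffAt_fderiv (hs : SmoothFn φ) {x : Euc n} (hx : x ≠ 0) :
    ContDiffAt ℝ 1 (fderiv ℝ φ) x :=
  (hs.contDiffAt hx).fderiv_right (by norm_cast)

lemma hasFDerivAt_fderiv (hs : SmoothFn φ) {x : Euc n} (hx : x ≠ 0) :
    HasFDerivAt (fderiv ℝ φ) (fderiv ℝ (fderiv ℝ φ) x) x :=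
  ((hs.contDiffAt_fderiv hx).differentiableAt one_ne_zero).hasFDerivAt

lemma hasFDerivAt_fderiv_apply (hs : SmoothFn φ) {x : Euc n} (hx : x ≠ 0) (w : Euc n) :
    HasFDerivAt (fun y => fderiv ℝ φ y w) ((fderiv ℝ (fderiv ℝ φ) x).flip w) x := by
  have h := (hs.hasFDerivAt_fderiv hx).clm_apply (hasFDerivAt_const w x)
  simpa using h

lemma continuousOn_fderiv_fderiv (hs : SmoothFn φ) :
    ContinuousOn (fderiv ℝ (fderiv ℝ φ)) {y : Euc n | y ≠ 0} := fun _ hx =>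
  ((hs.contDiffAt_fderiv hx).fderiv_right (m := 0) (by norm_num)).continuousAt.continuousWithinAt

lemma fderiv_fderiv_symm (hs : SmoothFn φ) {x : Euc n} (hx : x ≠ 0) (v w : Euc n) :
    fderiv ℝ (fderiv ℝ φ) x v w = fderiv ℝ (fderiv ℝ φ) x w v :=
  (hs.contDiffAt hx).isSymmSndFDerivAt (by simp; norm_cast) v w

lemma fderiv_fderiv_apply_self (hs : SmoothFn φ) (hφ : Homog0 φ) {x : Euc n} (hx : x ≠ 0) :
    fderiv ℝ (fderiv ℝ φ) x x x = 0 := by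
  have h := (hs.hasFDerivAt_fderiv hx).clm_apply (hasFDerivAt_id x)
  have h0 : (fun y : Euc n => fderiv ℝ φ y (id y)) = fun _ => 0 :=
    funext fun y => hφ.fderiv_apply_self y
  rw [h0] at h
  simpa [hφ.fderiv_apply_self] using DFunLike.congr_fun (h.unique (hasFDerivAt_const 0 x)) x

lemma hessS_eq (hs : SmoothFn φ) (hφ : Homog0 φ) {x v : Euc n} (hx : x ≠ 0) (hv : ⟪x, v⟫ = 0)
    (w : Euc n) : hessS φ x v w = fderiv ℝ (fderiv ℝ φ) x v w := by
  have h : (fun y => covD φ y w) = fun y => fderiv ℝ φ y w := funext fun y => hφ.covD_eq y w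
  simp [hessS, h, (hs.hasFDerivAt_fderiv_apply hx w).fderiv, tanProj, hv]

lemma aform_eq (hs : SmoothFn φ) (hφ : Homog0 φ) {x v w : Euc n} (hx : x ≠ 0)
    (hv : ⟪x, v⟫ = 0) (hw : ⟪x, w⟫ = 0) :
    Aform φ x v w = fderiv ℝ (fderiv ℝ φ) x v w +
      ((φ x - (φ x)⁻¹) / 2 - ‖gradS φ x‖ ^ 2 / (2 * φ x)) * ⟪v, w⟫ := by
  simp [Aform, hs.hessS_eq hφ hx hv, tanProj, hv, hw]

lemma posDef_amat (hs : SmoothFn φ) (hφ : Homog0 φ) (hc : UnifHConvex φ) {x : Euc n}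
    (hx : x ∈ uSphere n) {e : Fin n → Euc n} (he : OrthoFrame x e) : (Amat φ x e).PosDef := by
  have hx0 : x ≠ 0 := by
    rintro rfl
    simp [uSphere] at hx
  have hA : ∀ i j, Amat φ x e i j = fderiv ℝ (fderiv ℝ φ) x (e i) (e j) +
      ((φ x - (φ x)⁻¹) / 2 - ‖gradS φ x‖ ^ 2 / (2 * φ x)) * ⟪e i, e j⟫ :=
    fun i j => hs.aform_eq hφ hx0 (he.1 i) (he.1 j)
  refine Matrix.PosDef.of_dotProduct_mulVec_pos ?_ fun u hu => ?_
  · ext i j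
    rw [Matrix.conjTranspose_apply, star_trivial, hA, hA, hs.fderiv_fderiv_symm hx0,
      real_inner_comm]
  · have horth : Orthonormal ℝ e := orthonormal_iff_ite.2 he.2
    set v : Euc n := ∑ i, u i • e i with hv
    have hxv : ⟪x, v⟫ = 0 := by simp [hv, inner_sum, inner_smul_right, he.1]
    have hv0 : v ≠ 0 := fun h => hu <| funext <|
      Fintype.linearIndependent_iff.1 horth.linearIndependent u h
    have h := hc x hx v hxv hv0
    rw [hs.aform_eq hφ hx0 hxv hxv] at h
    refine h.trans_eq ?_
    simp only [hv, map_sum, map_smul, _root_.sum_apply, sum_inner, inner_sum,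
      _root_.smul_apply, inner_smul_left, inner_smul_right, dotProduct, Matrix.mulVec,
      hA, star_trivial, Pi.star_apply, smul_eq_mul, Finset.mul_sum, RCLike.conj_to_real,
      ← Finset.sum_add_distrib]
    rw [Finset.sum_comm]
    refine Finset.sum_congr rfl fun i _ => Finset.sum_congr rfl fun j _ => ?_
    rw [hs.fderiv_fderiv_symm hx0, real_inner_comm]
    ring

end SmoothFn

open Laplacian in
/-- Every point of the sphere has a tangent orthonormal frame, in which the Euclidean Laplacian of
a 0-homogeneous function is the trace of its Hessian. -/
lemma exists_orthoFrame_laplacian_eq {n : ℕ} {φ : Euc n → ℝ} (hs : SmoothFn φ) (hφ : Homog0 φ)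
    {x : Euc n} (hx : x ∈ uSphere n) :
    ∃ e : Fin n → Euc n, OrthoFrame x e ∧
      Δ φ x = ∑ i, fderiv ℝ (fderiv ℝ φ) x (e i) (e i) := by
  have hx1 : ‖x‖ = 1 := by simpa [uSphere] using hx
  have hx0 : x ≠ 0 := by
    rintro rfl
    simp at hx1
  have ho : Orthonormal ℝ (Set.domRestrict ({0} : Set (Fin (n + 1))) fun _ => x) :=
    ⟨fun _ => hx1, fun i j hij => (hij (Subsingleton.elim i j)).elim⟩
  obtain ⟨b, hb⟩ := ho.exists_orthonormalBasis_extension_of_card_eq (by simp)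
  have hb0 : b 0 = x := hb 0 rfl
  refine ⟨fun i => b i.succ, ⟨fun i => ?_, fun i j => ?_⟩, ?_⟩
  · rw [← hb0, b.inner_eq_ite, if_neg (Fin.succ_ne_zero i).symm]
  · simp [b.inner_eq_ite]
  · rw [InnerProductSpace.laplacian_eq_iteratedFDeriv_orthonormalBasis φ b]
    simp [iteratedFDeriv_two_apply, Fin.sum_univ_succ, hb0, hs.fderiv_fderiv_apply_self hφ hx0]

lemma continuous_mul_of_tsupport_subset {n : ℕ} {η g : Euc n → ℝ} (hη : Continuous η)
    (hη0 : tsupport η ⊆ {y | y ≠ 0}) (hg : ContinuousOn g {y | y ≠ 0}) :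
    Continuous fun y => η y * g y :=
  (hη.continuousOn.mul hg).continuous_of_tsupport_subset isOpen_ne
    (tsupport_mul_subset_left.trans hη0)

lemma laplacian_continuousOn {n : ℕ} {φ : Euc n → ℝ} (hs : SmoothFn φ) :
    ContinuousOn (Laplacian.laplacian φ) {y | y ≠ 0} := by
  rw [InnerProductSpace.laplacian_eq_iteratedFDeriv_stdOrthonormalBasis]
  simp only [iteratedFDeriv_two_apply, Matrix.cons_val_zero, Matrix.cons_val_one]
  exact continuousOn_finsetSum _ fun i _ =>
    (hs.continuousOn_fderiv_fderiv.clm_apply continuousOn_const).clm_apply continuousOn_const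

lemma laplacian_smul {n : ℕ} {φ : Euc n → ℝ} (hφ : Homog0 φ) {c : ℝ} (hc : 0 < c) (x : Euc n) :
    Laplacian.laplacian φ (c • x) = (c ^ 2)⁻¹ * Laplacian.laplacian φ x := by
  rw [InnerProductSpace.laplacian_eq_iteratedFDeriv_stdOrthonormalBasis]
  simp [iteratedFDeriv_two_apply, hφ.fderiv_fderiv_smul hc, Finset.mul_sum]

open MeasureTheory in
/-- Integrating by parts against a radial cutoff supported away from the origin, the Laplacian of a
0-homogeneous function has zero integral. -/
lemma integral_radial_mul_laplacian_eq_zero {n : ℕ} {φ η : Euc n → ℝ} (hs : SmoothFn φ)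
    (hφ : Homog0 φ) (hη : ContDiff ℝ 1 η) (hcs : HasCompactSupport η)
    (hη0 : tsupport η ⊆ {y | y ≠ 0}) (hrad : ∀ y, ∃ c : ℝ, ∀ v, fderiv ℝ η y v = c * ⟪y, v⟫) :
    ∫ y, η y * Laplacian.laplacian φ y = 0 := by
  set b := stdOrthonormalBasis ℝ (Euc n)
  have hgrad : ∀ v : Euc n, ContinuousOn (fun y => fderiv ℝ φ y v) {y | y ≠ 0} := fun v y hy =>
    (hs.hasFDerivAt_fderiv_apply hy v).continuousAt.continuousWithinAt
  have hhess : ∀ v : Euc n,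
      ContinuousOn (fun y => fderiv ℝ (fun z => fderiv ℝ φ z v) y v) {y | y ≠ 0} := fun v =>
    ((hs.continuousOn_fderiv_fderiv.clm_apply continuousOn_const).clm_apply
      continuousOn_const).congr fun y hy => by
        rw [(hs.hasFDerivAt_fderiv_apply hy v).fderiv, ContinuousLinearMap.flip_apply]
  have hη' : ∀ v : Euc n, Continuous fun y => fderiv ℝ η y v := fun v =>
    (hη.continuous_fderiv one_ne_zero).clm_apply continuous_const
  have hηcs : ∀ v : Euc n, HasCompactSupport fun y => fderiv ℝ η y v := fun v =>
    hcs.fderiv_apply (𝕜 := ℝ) v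
  have hint₁ : ∀ v : Euc n, Integrable fun y => fderiv ℝ η y v * fderiv ℝ φ y v := fun v =>
    (continuous_mul_of_tsupport_subset (hη' v)
      ((tsupport_fderiv_apply_subset ℝ v).trans hη0) (hgrad v)).integrable_of_hasCompactSupport
      (hηcs v).mul_right
  have hint₂ : ∀ v : Euc n,
      Integrable fun y => η y * fderiv ℝ (fun z => fderiv ℝ φ z v) y v := fun v =>
    (continuous_mul_of_tsupport_subset hη.continuous hη0
      (hhess v)).integrable_of_hasCompactSupport hcs.mul_right
  have hint₃ : ∀ v : Euc n, Integrable fun y => η y * fderiv ℝ φ y v := fun v =>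
    (continuous_mul_of_tsupport_subset hη.continuous hη0
      (hgrad v)).integrable_of_hasCompactSupport hcs.mul_right
  have hparts : ∀ v : Euc n, ∫ y, η y * fderiv ℝ (fun z => fderiv ℝ φ z v) y v =
      -∫ y, fderiv ℝ η y v * fderiv ℝ φ y v := fun v =>
    integral_mul_fderiv_eq_neg_fderiv_mul_of_integrable (hint₁ v) (hint₂ v) (hint₃ v)
      (fun y _ => hη.differentiable one_ne_zero y)
      fun y hy => (hs.hasFDerivAt_fderiv_apply (hη0 hy) v).differentiableAt
  have hlap : ∀ y, η y * Laplacian.laplacian φ y =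
      ∑ i, η y * fderiv ℝ (fun z => fderiv ℝ φ z (b i)) y (b i) := by
    intro y
    by_cases hy : y = 0
    · have h0 : η y = 0 := by
        by_contra h
        exact hη0 (subset_tsupport η h) hy
      simp [h0]
    · rw [InnerProductSpace.laplacian_eq_iteratedFDeriv_orthonormalBasis φ b, Finset.mul_sum]
      refine Finset.sum_congr rfl fun i _ => ?_
      simp [iteratedFDeriv_two_apply, (hs.hasFDerivAt_fderiv_apply hy _).fderiv]
  have hzero : ∀ y, ∑ i, fderiv ℝ η y (b i) * fderiv ℝ φ y (b i) = 0 := by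
    intro y
    obtain ⟨c, hc⟩ := hrad y
    have h : fderiv ℝ φ y (∑ i, ⟪b i, y⟫ • b i) = 0 := by
      rw [b.sum_repr', hφ.fderiv_apply_self]
    simp only [map_sum, map_smul, smul_eq_mul] at h
    simp only [hc, mul_assoc, ← Finset.mul_sum, real_inner_comm _ y, h, mul_zero]
  simp only [hlap]
  rw [integral_finsetSum _ fun i _ => hint₂ (b i)]
  simp only [hparts, Finset.sum_neg_distrib]
  rw [← integral_finsetSum _ fun i _ => hint₁ (b i)]
  simp [hzero]

open MeasureTheory in
/-- A smooth subharmonic function on the sphere is harmonic. -/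
lemma laplacian_eq_zero_of_nonneg {n : ℕ} {φ : Euc n → ℝ} (hs : SmoothFn φ) (hφ : Homog0 φ)
    (h : ∀ x ∈ uSphere n, 0 ≤ Laplacian.laplacian φ x) :
    ∀ x ∈ uSphere n, Laplacian.laplacian φ x = 0 := by
  intro x hx
  let f : ContDiffBump (1 : ℝ) := ⟨1 / 4, 1 / 2, by norm_num, by norm_num⟩
  let η : Euc n → ℝ := fun y => f (‖y‖ ^ 2)
  have hη : ContDiff ℝ 1 η := f.contDiff.comp (contDiff_norm_sq ℝ)
  have hcs : HasCompactSupport η := by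
    refine HasCompactSupport.intro (isCompact_closedBall (0 : Euc n) 2) fun y hy => ?_
    refine f.zero_of_le_dist ?_
    rw [mem_closedBall_zero_iff, not_le] at hy
    rw [Real.dist_eq]
    refine le_trans ?_ (le_abs_self _)
    change (1 / 2 : ℝ) ≤ _
    nlinarith
  have hη0 : tsupport η ⊆ {y | y ≠ 0} := by
    intro y hy hy0
    have h₁ := tsupport_comp_subset_preimage f (f := fun y : Euc n => ‖y‖ ^ 2) (by fun_prop) hy
    rw [Set.mem_preimage, f.tsupport_eq, Metric.mem_closedBall, hy0, Real.dist_eq] at h₁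
    change _ ≤ (1 / 2 : ℝ) at h₁
    norm_num at h₁
  have hrad : ∀ y, ∃ c : ℝ, ∀ v, fderiv ℝ η y v = c * ⟪y, v⟫ := by
    intro y
    have hd : HasDerivAt f (deriv f (‖y‖ ^ 2)) (‖y‖ ^ 2) :=
      ((f.contDiff (n := 1)).differentiable one_ne_zero _).hasDerivAt
    have hc := hd.comp_hasFDerivAt y (hasStrictFDerivAt_norm_sq y).hasFDerivAt
    refine ⟨2 * deriv f (‖y‖ ^ 2), fun v => ?_⟩
    change fderiv ℝ (f ∘ fun y => ‖y‖ ^ 2) y v = _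
    rw [hc.fderiv]
    simp
    ring
  have hint := integral_radial_mul_laplacian_eq_zero hs hφ hη hcs hη0 hrad
  have hnonneg : ∀ y, 0 ≤ η y * Laplacian.laplacian φ y := by
    intro y
    by_cases hy : y = 0
    · have h0 : η y = 0 := by
        by_contra h
        exact hη0 (subset_tsupport η h) hy
      simp [h0]
    · refine mul_nonneg f.nonneg ?_
      have hn : 0 < ‖y‖ := norm_pos_iff.2 hy
      have hmem : ‖y‖⁻¹ • y ∈ uSphere n := by simp [uSphere, norm_smul, hn.ne']
      have h' := h _ hmem
      rw [laplacian_smul hφ (inv_pos.2 hn)] at h'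
      exact nonneg_of_mul_nonneg_right h' (by positivity)
  have hη1 : η x = 1 := by
    refine f.one_of_mem_closedBall ?_
    have : ‖x‖ = 1 := by simpa [uSphere] using hx
    rw [this, one_pow]
    exact Metric.mem_closedBall_self f.rIn_pos.le
  by_contra hne
  have hpos := (continuous_mul_of_tsupport_subset hη.continuous hη0
    (laplacian_continuousOn hs)).integral_pos_of_hasCompactSupport_nonneg_nonzero
    (μ := volume) (x := x) hcs.mul_right hnonneg (by simpa [hη1] using hne)
  exact hpos.ne' hint

/-- If the Laplacian of a solution is nonpositive at a point of the sphere, the solution takes there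
the value of the constant solution, and the Laplacian vanishes. -/
lemma eq_sqrt_of_laplacian_nonpos {n k : ℕ} {p : ℝ} (hn : 0 < n) (hk : 1 ≤ k) (hkn : k ≤ n)
    (hp : 2 * (k : ℝ) < p) {φ : Euc n → ℝ} (hφ : Homog0 φ) (hs : SmoothFn φ)
    (hpos : ∀ x ∈ uSphere n, 0 < φ x) (hc : UnifHConvex φ)
    (hsol : SolvesCM n k p
      (fun _ => (k : ℝ) ^ k * (p - 2 * (k : ℝ)) ^ ((p - 2 * (k : ℝ)) / 2) / p ^ (p / 2) *
        (n.choose k : ℝ)) φ)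
    {x : Euc n} (hx : x ∈ uSphere n) (hL : Laplacian.laplacian φ x ≤ 0) :
    φ x = √(p / (p - 2 * k)) ∧ 0 ≤ Laplacian.laplacian φ x := by
  have hx0 : x ≠ 0 := by
    rintro rfl
    simp [uSphere] at hx
  obtain ⟨e, he, hLe⟩ := exists_orthoFrame_laplacian_eq hs hφ hx
  have hM := hs.posDef_amat hφ hc hx he
  have hφx := hpos x hx
  have hn0 : (0 : ℝ) < n := by exact_mod_cast hn
  set K := (φ x - (φ x)⁻¹) / 2 - ‖gradS φ x‖ ^ 2 / (2 * φ x) with hK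
  have hKle : K ≤ (φ x - (φ x)⁻¹) / 2 := sub_le_self _ (by positivity)
  have htr : (Amat φ x e).trace / n = Laplacian.laplacian φ x / n + K := by
    have : (Amat φ x e).trace = Laplacian.laplacian φ x + n * K := by
      simp only [Matrix.trace, Matrix.diag_apply, Amat, Matrix.of_apply,
        hs.aform_eq hφ hx0 (he.1 _) (he.1 _), he.2, hLe, ← hK, if_true, mul_one,
        Finset.sum_add_distrib]
      simp
    rw [this]
    field_simp
  have : Nonempty (Fin n) := ⟨⟨0, hn⟩⟩
  have htpos : 0 < (Amat φ x e).trace / n :=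
    div_pos (Finset.sum_pos (fun i _ => hM.diag_pos) Finset.univ_nonempty) hn0
  have hle := sigmaMat_le_of_posDef k hM
  rw [hsol x hx e he, ← mul_assoc, mul_comm] at hle
  have hle' := le_of_mul_le_mul_left hle (by exact_mod_cast Nat.choose_pos hkn)
  rw [htr] at htpos hle'
  have hLn : Laplacian.laplacian φ x / n ≤ 0 := div_nonpos_of_nonpos_of_nonneg hL hn0.le
  have hsle : Laplacian.laplacian φ x / n + K ≤ (φ x - (φ x)⁻¹) / 2 := by linarith
  have h1 : 1 < φ x := by
    by_contra! h
    have := one_le_inv₀ hφx |>.2 h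
    linarith
  have heq := eq_sqrt_of_le_half_sub_inv_pow hk hp h1
    (hle'.trans (pow_le_pow_left₀ htpos.le hsle k))
  refine ⟨heq, ?_⟩
  by_contra! hlt
  have hslt : Laplacian.laplacian φ x / n + K < (φ x - (φ x)⁻¹) / 2 := by
    have := div_neg_of_neg_of_pos hlt hn0
    linarith
  have h2 := hle'.trans_lt (pow_lt_pow_left₀ hslt htpos.le (by omega))
  rw [heq, sqrt_rpow_mul_eq_half_sub_inv_pow hk hp] at h2
  exact lt_irrefl _ h2

/-- **Uniqueness of constant solutions, case `p > 2k`** (Lemma 5.1(3) of Luo–Wei):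
for `γ = γ_p := k^k (p-2k)^{(p-2k)/2} p^{-p/2} C(n,k)` the equation
`σ_k(A[φ]) = φ^{p-k} γ_p` has a unique even, uniformly h-convex solution, namely the
constant `φ ≡ (p/(p-2k))^{1/2}`. -/
theorem constant_solution_p_gt_two_k (n k : ℕ) (p : ℝ)
    (hn : 2 ≤ n) (hk1 : 1 ≤ k) (hk2 : k ≤ n - 1) (hp : 2 * (k : ℝ) < p) :
    (UnifHConvex (fun _ : Euc n => Real.sqrt (p / (p - 2 * (k : ℝ)))) ∧
      SolvesCM n k p
        (fun _ => (k : ℝ) ^ k * (p - 2 * (k : ℝ)) ^ ((p - 2 * (k : ℝ)) / 2) / p ^ (p / 2) *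
          (n.choose k : ℝ))
        (fun _ => Real.sqrt (p / (p - 2 * (k : ℝ))))) ∧
    ∀ φ : Euc n → ℝ, Homog0 φ → SmoothFn φ → EvenFn φ →
      (∀ x ∈ uSphere n, 0 < φ x) → UnifHConvex φ →
      SolvesCM n k p
        (fun _ => (k : ℝ) ^ k * (p - 2 * (k : ℝ)) ^ ((p - 2 * (k : ℝ)) / 2) / p ^ (p / 2) *
          (n.choose k : ℝ)) φ →
      ∀ x ∈ uSphere n, φ x = Real.sqrt (p / (p - 2 * (k : ℝ))) := by
  have hkn : k ≤ n := by omega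
  have hn0 : 0 < n := by omega
  refine ⟨⟨unifHConvex_const (one_lt_sqrt_div_sub hk1 hp), fun x _ e he => ?_⟩,
    fun φ hφ hs _ hpos hc hsol x hx => ?_⟩
  · rw [amat_const _ he, sigmaMat_smul_one, ← sqrt_rpow_mul_eq_half_sub_inv_pow hk1 hp]
    ring
  · have hL : ∀ y ∈ uSphere n, 0 ≤ Laplacian.laplacian φ y := fun y hy =>
      (le_total 0 (Laplacian.laplacian φ y)).elim id fun h =>
        (eq_sqrt_of_laplacian_nonpos hn0 hk1 hkn hp hφ hs hpos hc hsol hy h).2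
    exact (eq_sqrt_of_laplacian_nonpos hn0 hk1 hkn hp hφ hs hpos hc hsol hx
      (laplacian_eq_zero_of_nonneg hs hφ hL x hx).le).1
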